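/- Let L = Se_1 + ⋯ + Se_s be a finitely generated S-module. Then for almost all α there exist elements (e_1)_α, …, (e_s)_α ∈ L_α such that (Se_j)_α = S_α(e_j)_α for j = 1, …, s and L_α = S_α(e_1)_α + ⋯ + S_α(e_s)_α. In particular, if a_1, …, a_s ∈ S and 𝔞 = (a_1, …, a_s), then 𝔞_α = ((a_1)_α, …, (a_s)_α). -/

import Mathlib

set_option maxHeartbeats 1000000
set_option synthInstance.maxHeartbeats 1000000

noncomputable section

namespace Spl

open MvPolynomial

/-- "Q(α) holds for almost all α ∈ K^m", i.e. away from a proper algebraic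
subvariety of `K^m`. -/
def AlmostAll (K : Type) [Field K] (m : ℕ) (Q : (Fin m → K) → Prop) : Prop :=
  ∃ c : MvPolynomial (Fin m) K, c ≠ 0 ∧ ∀ α : Fin m → K, MvPolynomial.eval α c ≠ 0 → Q α

variable (k K : Type) [Field k] [Field K] [Algebra k K]

/-- the field k(u) of rational functions in u = (u_1, ..., u_m) -/
abbrev kU (m : ℕ) := FractionRing (MvPolynomial (Fin m) k)

/-- the polynomial ring R = k(u)[X_1, ..., X_n] -/
abbrev Rg (m n : ℕ) := MvPolynomial (Fin n) (kU k m)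

/-- the subfield k(α) ⊆ K generated by α = (α_1, ..., α_m) over k -/
abbrev kA {m : ℕ} (α : Fin m → K) := IntermediateField.adjoin k (Set.range α)

/-- the polynomial ring R_α = k(α)[X_1, ..., X_n] -/
abbrev Ra {m : ℕ} (n : ℕ) (α : Fin m → K) := MvPolynomial (Fin n) (kA k K α)

/-- evaluation u ↦ α, from k[u] to k(α) -/
def evalα {m : ℕ} (α : Fin m → K) : MvPolynomial (Fin m) k →+* kA k K α :=
  (MvPolynomial.aeval fun i =>
    (⟨α i, IntermediateField.subset_adjoin k (Set.range α) ⟨i, rfl⟩⟩ : kA k K α)).toRingHom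

/-- the inclusion k[u][X] → R = k(u)[X] -/
def toR (m n : ℕ) : MvPolynomial (Fin n) (MvPolynomial (Fin m) k) →+* Rg k m n :=
  MvPolynomial.map (algebraMap (MvPolynomial (Fin m) k) (kU k m))

/-- substitution u ↦ α, from k[u][X] to R_α = k(α)[X] -/
def toRa {m : ℕ} (n : ℕ) (α : Fin m → K) :
    MvPolynomial (Fin n) (MvPolynomial (Fin m) k) →+* Ra k K n α :=
  MvPolynomial.map (evalα k K α)

/-- Krull's specialization I_α = { f(α,X) | f(u,X) ∈ I ∩ k[u,X] } of an ideal I ⊆ R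
(as an ideal of R_α, i.e. the ideal spanned by the specialized elements). -/
def idealSpec {m : ℕ} (n : ℕ) (α : Fin m → K) (I : Ideal (Rg k m n)) :
    Ideal (Ra k K n α) :=
  Ideal.span (toRa k K n α '' { f | toR k m n f ∈ I })

/-- `ElemSpec k K n α f fα` : fα is the specialization of f ∈ R at α, i.e. writing
f = p(u,X)/q(u) with q(α) ≠ 0 one has fα = p(α,X)/q(α). -/
def ElemSpec {m : ℕ} (n : ℕ) (α : Fin m → K) (f : Rg k m n) (fα : Ra k K n α) : Prop :=
  ∃ (p : MvPolynomial (Fin n) (MvPolynomial (Fin m) k)) (q : MvPolynomial (Fin m) k),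
    evalα k K α q ≠ 0 ∧
    MvPolynomial.C (algebraMap (MvPolynomial (Fin m) k) (kU k m) q) * f = toR k m n p ∧
    MvPolynomial.C (evalα k K α q) * fα = toRa k K n α p

variable {k K}

/-- `LocElemSpec P ℘ a aα` : aα ∈ S_α = (R_α)_℘ is the specialization of a ∈ S = R_P,
i.e. writing a = f/g with f, g ∈ R, g ∉ P, one has g_α ∉ ℘ and aα = f_α/g_α. -/
def LocElemSpec {m n : ℕ} {α : Fin m → K} (P : Ideal (Rg k m n)) [P.IsPrime]
    (℘ : Ideal (Ra k K n α)) [℘.IsPrime]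
    {S : Type} [CommRing S] [Algebra (Rg k m n) S] [IsLocalization.AtPrime S P]
    {Sα : Type} [CommRing Sα] [Algebra (Ra k K n α) Sα] [IsLocalization.AtPrime Sα ℘]
    (a : S) (aα : Sα) : Prop :=
  ∃ (f g : Rg k m n) (fα gα : Ra k K n α) (hg : g ∈ P.primeCompl)
    (hgα : gα ∈ ℘.primeCompl),
    ElemSpec k K n α f fα ∧ ElemSpec k K n α g gα ∧
    a = IsLocalization.mk' S f ⟨g, hg⟩ ∧
    aα = IsLocalization.mk' Sα fα ⟨gα, hgα⟩

/-- entrywise specialization of matrices, relative to an element-specialization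
relation `E`. -/
def MatSpec {S T : Type} (E : S → T → Prop) {r s : ℕ}
    (A : Matrix (Fin r) (Fin s) S) (B : Matrix (Fin r) (Fin s) T) : Prop :=
  ∀ i j, E (A i j) (B i j)

/-- the cokernel of the linear map attached to a matrix A, i.e. the module
presented by A. -/
abbrev MatCoker {S : Type} [CommRing S] {r s : ℕ} (A : Matrix (Fin r) (Fin s) S) :=
  (Fin r → S) ⧸ LinearMap.range A.mulVecLin

/-- a finite free presentation F_1 → F_0 → L → 0 of the module L, where the map
F_1 → F_0 is given by the matrix A and the map F_0 → L is π. -/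
structure Present (S : Type) [CommRing S] (r s : ℕ) (L : Type) [AddCommGroup L]
    [Module S L] where
  A : Matrix (Fin r) (Fin s) S
  π : (Fin r → S) →ₗ[S] L
  surj : Function.Surjective π
  ker_eq : LinearMap.ker π = LinearMap.range A.mulVecLin

theorem comm_le {S : Type} [CommRing S] {r s r' s' : ℕ} {B : Matrix (Fin r) (Fin s) S}
    {C : Matrix (Fin r') (Fin s') S} {W : Matrix (Fin r') (Fin r) S}
    {W1 : Matrix (Fin s') (Fin s) S} (h : W * B = C * W1) :
    LinearMap.range B.mulVecLin ≤ (LinearMap.range C.mulVecLin).comap W.mulVecLin := by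
  rintro x ⟨y, rfl⟩
  exact ⟨W1.mulVecLin y, by
    simp only [Matrix.mulVecLin_apply, Matrix.mulVec_mulVec, h]⟩

/-- the map between the modules presented by B and C induced by the matrix W
(a specialization of a lift of a map between the presented modules). -/
def cokerMap {S : Type} [CommRing S] {r s r' s' : ℕ} {B : Matrix (Fin r) (Fin s) S}
    {C : Matrix (Fin r') (Fin s') S} (W : Matrix (Fin r') (Fin r) S)
    (h : LinearMap.range B.mulVecLin ≤ (LinearMap.range C.mulVecLin).comap W.mulVecLin) :
    MatCoker B →ₗ[S] MatCoker C :=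
  Submodule.mapQ _ _ W.mulVecLin h

/-- a lift of a homomorphism v : L → M to given finite free presentations of L and M:
a commutative diagram whose vertical maps are given by the matrices V1, V0. -/
structure MapLift {S : Type} [CommRing S] {rL sL rM sM : ℕ} {L M : Type}
    [AddCommGroup L] [Module S L] [AddCommGroup M] [Module S M]
    (pL : Present S rL sL L) (pM : Present S rM sM M) (v : L →ₗ[S] M) where
  V0 : Matrix (Fin rM) (Fin rL) S
  V1 : Matrix (Fin sM) (Fin sL) S
  comm0 : pM.π ∘ₗ V0.mulVecLin = v ∘ₗ pL.π
  comm1 : V0 * pL.A = pM.A * V1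

/-- Krull dimension of a module, dim L = dim S/Ann L. -/
def moduleDim (S : Type) [CommRing S] (L : Type) [AddCommGroup L] [Module S L] :
    WithBot ℕ∞ :=
  ringKrullDim (S ⧸ Module.annihilator S L)

/-- height of an ideal: the infimum of dim S_p over the primes p ⊇ I. -/
def idealHeight {S : Type} [CommRing S] (I : Ideal S) : WithBot ℕ∞ :=
  sInf { d | ∃ (p : Ideal S) (hp : p.IsPrime), I ≤ p ∧
    d = ringKrullDim (Localization (@Ideal.primeCompl _ _ p hp)) }

/-- length of a module: the longest chain of submodules. -/
def moduleLength (S : Type) [CommRing S] (L : Type) [AddCommGroup L] [Module S L] :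
    WithBot ℕ∞ :=
  Order.krullDim (Submodule S L)

/-- grade(𝔞, L) ≥ t : there is an L-regular sequence of length t in 𝔞. -/
def GradeGE {S : Type} [CommRing S] (𝔞 : Ideal S) (L : Type) [AddCommGroup L]
    [Module S L] (t : ℕ) : Prop :=
  ∃ rs : List S, rs.length = t ∧ (∀ x ∈ rs, x ∈ 𝔞) ∧ RingTheory.Sequence.IsRegular L rs

/-- grade(𝔞, L) : the length of a maximal L-regular sequence in 𝔞. -/
def grade {S : Type} [CommRing S] (𝔞 : Ideal S) (L : Type) [AddCommGroup L]
    [Module S L] : ℕ∞ :=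
  sSup { t : ℕ∞ | ∃ t' : ℕ, t = (t' : ℕ∞) ∧ GradeGE 𝔞 L t' }

/-- depth of a module over a local ring: grade(𝔪, L). -/
def depth (S : Type) [CommRing S] [IsLocalRing S] (L : Type) [AddCommGroup L]
    [Module S L] : ℕ∞ :=
  grade (IsLocalRing.maximalIdeal S) L

/-- proj dim L ≤ d : L admits a finite free resolution of length ≤ d, encoded as a
(possibly infinite) free resolution ⋯ → F_1 → F_0 → L → 0 with F_j = 0 for j > d. -/
def ProjDimLE (S : Type) [CommRing S] (L : Type) [AddCommGroup L] [Module S L]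
    (d : ℕ) : Prop :=
  ∃ (r : ℕ → ℕ) (A : ∀ j : ℕ, Matrix (Fin (r j)) (Fin (r (j + 1))) S)
    (π : (Fin (r 0) → S) →ₗ[S] L),
    Function.Surjective π ∧ LinearMap.ker π = LinearMap.range (A 0).mulVecLin ∧
    (∀ j : ℕ, LinearMap.ker (A j).mulVecLin = LinearMap.range (A (j + 1)).mulVecLin) ∧
    ∀ j : ℕ, d < j → r j = 0

/-- projective dimension of a module, as an extended natural number. -/
def projDim (S : Type) [CommRing S] (L : Type) [AddCommGroup L] [Module S L] : ℕ∞ :=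
  sInf { d : ℕ∞ | ∃ d' : ℕ, d = (d' : ℕ∞) ∧ ProjDimLE S L d' }

/-- the i-th local cohomology module H^i_𝔞(L) as a module. -/
abbrev localCoh {S : Type} [CommRing S] (𝔞 : Ideal S) (i : ℕ) (L : Type)
    [AddCommGroup L] [Module S L] : ModuleCat S :=
  (localCohomology 𝔞 i).obj (ModuleCat.of S L)

/-- the colon submodule (0 :_L 𝔞) = { x ∈ L | 𝔞 x = 0 }. -/
def colonSubmodule {S : Type} [CommRing S] (𝔞 : Ideal S) (L : Type) [AddCommGroup L]
    [Module S L] : Submodule S L where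
  carrier := { x | ∀ c ∈ 𝔞, c • x = 0 }
  add_mem' := by
    intro a b ha hb c hc
    rw [smul_add, ha c hc, hb c hc, add_zero]
  zero_mem' := by
    intro c _
    rw [smul_zero]
  smul_mem' := by
    intro s x hx c hc
    rw [smul_comm, hx c hc, smul_zero]

/-- a (partial) system of parameters: the d = dim L elements a_1, ..., a_d lie in the
maximal ideal and L/(a_1, ..., a_d)L has dimension ≤ 0. -/
def IsSOP (S : Type) [CommRing S] [IsLocalRing S] (L : Type) [AddCommGroup L]
    [Module S L] {d : ℕ} (a : Fin d → S) : Prop :=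
  (∀ i, a i ∈ IsLocalRing.maximalIdeal S) ∧
  moduleDim S L = (d : ℕ∞) ∧
  moduleDim S (L ⧸ (Ideal.span (Set.range a) • (⊤ : Submodule S L))) ≤ 0

/-- a standard system of parameters: (a_1, ..., a_d) H^i_𝔪(L/(a_1, ..., a_j)L) = 0
for all i + j < d. -/
def IsStandardSOP (S : Type) [CommRing S] [IsLocalRing S] (L : Type) [AddCommGroup L]
    [Module S L] {d : ℕ} (a : Fin d → S) : Prop :=
  IsSOP S L a ∧
  ∀ i j : ℕ, i + j < d →
    Ideal.span (Set.range a) ≤ Module.annihilator S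
      (localCoh (IsLocalRing.maximalIdeal S) i
        (L ⧸ (Ideal.span (a '' { x : Fin d | (x : ℕ) < j }) • (⊤ : Submodule S L))))

/-- a standard ideal for L: an 𝔪-primary ideal 𝔞 such that every system of
parameters of L contained in 𝔞 is standard. -/
def IsStandardIdeal (S : Type) [CommRing S] [IsLocalRing S] (L : Type) [AddCommGroup L]
    [Module S L] (𝔞 : Ideal S) : Prop :=
  𝔞.radical = IsLocalRing.maximalIdeal S ∧
  ∀ (d : ℕ) (a : Fin d → S), (∀ i, a i ∈ 𝔞) → IsSOP S L a → IsStandardSOP S L a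


/-- A set of polynomials has a finite subset of nonzero elements whose leading exponents
divide the leading exponents of all its nonzero elements. -/
theorem exists_finset_degree_le {σ A : Type*} [Finite σ] [CommRing A] (mo : MonomialOrder σ)
    (J : Set (MvPolynomial σ A)) :
    ∃ s : Finset (MvPolynomial σ A), (∀ b ∈ s, b ∈ J ∧ b ≠ 0) ∧
      ∀ f ∈ J, f ≠ 0 → ∃ b ∈ s, mo.degree b ≤ mo.degree f := by
  classical
  set D : Set (σ →₀ ℕ) := mo.degree '' {f | f ∈ J ∧ f ≠ 0} with hD
  have hfin : {d | Minimal (· ∈ D) d}.Finite :=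
    WellQuasiOrderedLE.finite_of_isAntichain (setOfPred_minimal_antichain _)
  have hex : ∀ d ∈ hfin.toFinset, ∃ f, (f ∈ J ∧ f ≠ 0) ∧ mo.degree f = d := by
    intro d hd
    obtain ⟨f, hf, rfl⟩ := (hfin.mem_toFinset.1 hd).prop
    exact ⟨f, hf, rfl⟩
  choose F hF using hex
  refine ⟨hfin.toFinset.attach.image fun d => F d.1 d.2, ?_, ?_⟩
  · intro b hb
    obtain ⟨d, -, rfl⟩ := Finset.mem_image.1 hb
    exact (hF d.1 d.2).1
  · intro f hf hf0
    obtain ⟨d, hdle, hd⟩ := (Set.isPWO_of_wellQuasiOrderedLE D).exists_le_minimal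
      (⟨f, ⟨hf, hf0⟩, rfl⟩ : mo.degree f ∈ D)
    have hd' : d ∈ hfin.toFinset := hfin.mem_toFinset.2 hd
    exact ⟨F d hd', Finset.mem_image.2 ⟨⟨d, hd'⟩, Finset.mem_attach _ _, rfl⟩,
      (hF d hd').2.trans_le hdle⟩

/-- If `Q + (g)` has a family of elements with unit leading coefficients whose leading
exponents divide those of all its nonzero elements, then `g` stays regular modulo `Q` after
reducing the coefficients along a surjection. -/
theorem mem_map_of_mul_mem_map {σ B κ : Type*} [CommRing B] [CommRing κ]
    (mo : MonomialOrder σ) (φ : B →+* κ) (hφ : Function.Surjective φ)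
    (Q : Ideal (MvPolynomial σ B)) [Q.IsPrime] {g : MvPolynomial σ B} (hg : g ∉ Q)
    {ι : Type*} (b : ι → MvPolynomial σ B) (hb : ∀ i, IsUnit (mo.leadingCoeff (b i)))
    (hbJ : ∀ i, b i ∈ Q ⊔ Ideal.span {g})
    (hJ : ∀ f ∈ Q ⊔ Ideal.span {g}, f ≠ 0 → ∃ i, mo.degree (b i) ≤ mo.degree f)
    {h : MvPolynomial σ κ}
    (hh : MvPolynomial.map φ g * h ∈ Q.map (MvPolynomial.map φ)) :
    h ∈ Q.map (MvPolynomial.map φ) := by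
  classical
  have hs : Function.Surjective (MvPolynomial.map (σ := σ) φ) := MvPolynomial.map_surjective φ hφ
  obtain ⟨h, rfl⟩ := hs h
  obtain ⟨p, hp, hpg⟩ := (Ideal.mem_map_iff_of_surjective _ hs).1 hh
  set f := g * h - p with hf
  have hcoeff : ∀ d, φ (coeff d f) = 0 := by
    intro d
    rw [← MvPolynomial.coeff_map, hf, map_sub, hpg, map_mul, sub_self, coeff_zero]
  have hdiv : ∀ d : σ →₀ ℕ, ∃ p' t r : MvPolynomial σ B, p' ∈ Q ∧
      monomial d (1 : B) = p' + g * t + r ∧ ∀ e ∈ r.support, ∀ i, ¬ mo.degree (b i) ≤ e := by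
    intro d
    obtain ⟨c, r, h1, -, h3⟩ := mo.div hb (monomial d (1 : B))
    have hmem : Finsupp.linearCombination _ b c ∈ Q ⊔ Ideal.span {g} := by
      rw [Finsupp.linearCombination_apply]
      exact Ideal.sum_mem _ fun i _ => Ideal.mul_mem_left _ _ (hbJ i)
    obtain ⟨p', hp', y, hy, hpy⟩ := Submodule.mem_sup.1 hmem
    obtain ⟨t, rfl⟩ := Ideal.mem_span_singleton'.1 hy
    exact ⟨p', t, r, hp', by rw [h1, ← hpy, mul_comm t], h3⟩
  choose p' t r hp' hd hr using hdiv
  have hmon : ∀ d (c : B), monomial d c = C c * p' d + g * (C c * t d) + C c * r d := by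
    intro d c
    rw [show monomial d c = C c * monomial d 1 by rw [C_mul_monomial, mul_one], hd]
    ring
  set T := ∑ d ∈ f.support, C (coeff d f) * t d with hT
  set ρ := ∑ d ∈ f.support, C (coeff d f) * r d with hρ
  set p₁ := ∑ d ∈ f.support, C (coeff d f) * p' d with hp₁
  have hp₁Q : p₁ ∈ Q := Ideal.sum_mem _ fun d _ => Ideal.mul_mem_left _ _ (hp' d)
  have hfs : f = p₁ + g * T + ρ := by
    conv_lhs => rw [f.as_sum]
    rw [hT, hρ, hp₁, Finset.mul_sum, ← Finset.sum_add_distrib, ← Finset.sum_add_distrib]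
    exact Finset.sum_congr rfl fun d _ => hmon d _
  have hρ0 : ρ = 0 := by
    by_contra h0
    have hρJ : ρ ∈ Q ⊔ Ideal.span {g} := by
      have : ρ = -(p + p₁) + g * (h - T) := by
        linear_combination hf - hfs
      rw [this]
      exact Submodule.add_mem_sup (Q.neg_mem (Q.add_mem hp hp₁Q))
        (Ideal.mul_mem_right _ _ (Ideal.mem_span_singleton_self g))
    obtain ⟨i, hi⟩ := hJ ρ hρJ h0
    have hsup := mo.degree_mem_support h0
    rw [hρ] at hsup
    obtain ⟨d, -, hd'⟩ := Finset.mem_biUnion.1 (support_sum hsup)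
    rw [← hρ] at hd'
    rw [C_mul'] at hd'
    exact hr d _ (support_smul hd') i hi
  have hmem : h - T ∈ Q := by
    refine ((Ideal.IsPrime.mem_or_mem ‹Q.IsPrime› (x := g) (y := h - T) ?_)).resolve_left hg
    have : g * (h - T) = p + p₁ := by linear_combination hfs + hρ0 - hf
    rw [this]
    exact Q.add_mem hp hp₁Q
  have hT0 : MvPolynomial.map φ T = 0 := by
    rw [hT, map_sum]
    exact Finset.sum_eq_zero fun d _ => by rw [map_mul, map_C, hcoeff, C_0, zero_mul]
  have := Ideal.mem_map_of_mem (MvPolynomial.map φ) hmem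
  rwa [map_sub, hT0, sub_zero] at this

theorem degree_map_of_injective {σ A B : Type*} [CommRing A] [CommRing B]
    (mo : MonomialOrder σ) {φ : A →+* B} (hφ : Function.Injective φ) (f : MvPolynomial σ A) :
    mo.degree (MvPolynomial.map φ f) = mo.degree f := by
  simp only [MonomialOrder.degree, MvPolynomial.support_map_of_injective f hφ]

/-- Generic regularity: an element outside a prime `𝔭` of `A[X]` with `𝔭 ∩ A = 0` remains
regular modulo `𝔭` at all points of a nonempty basic open subset of `Spec A`. -/
theorem exists_forall_mem_map_of_mul_mem_map {σ A : Type*} [Finite σ] [CommRing A] [IsDomain A]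
    (𝔭 : Ideal (MvPolynomial σ A)) [𝔭.IsPrime] (h𝔭 : ∀ a : A, C a ∈ 𝔭 → a = 0)
    {g : MvPolynomial σ A} (hg : g ∉ 𝔭) :
    ∃ c : A, c ≠ 0 ∧ ∀ {κ : Type*} [Field κ] (φ : A →+* κ), φ c ≠ 0 →
      (∀ z, ∃ a b, φ b ≠ 0 ∧ z * φ b = φ a) → ∀ h : MvPolynomial σ κ,
      MvPolynomial.map φ g * h ∈ 𝔭.map (MvPolynomial.map φ) →
      h ∈ 𝔭.map (MvPolynomial.map φ) := by
  classical
  obtain ⟨_⟩ : Nonempty (LinearOrder σ) := ⟨linearOrderOfSTO WellOrderingRel⟩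
  let mo : MonomialOrder σ := MonomialOrder.lex
  obtain ⟨s, hs, hsJ⟩ := exists_finset_degree_le mo
    ((𝔭 ⊔ Ideal.span {g} : Ideal (MvPolynomial σ A)) : Set (MvPolynomial σ A))
  refine ⟨∏ b ∈ s, mo.leadingCoeff b,
    Finset.prod_ne_zero_iff.2 fun b hb => mo.leadingCoeff_ne_zero_iff.2 (hs b hb).2, ?_⟩
  intro κ _ φ hφc hκ h hh
  let 𝔪 := RingHom.ker φ
  have : 𝔪.IsPrime := RingHom.ker_isPrime φ
  let B := Localization.AtPrime 𝔪
  let ι : A →+* B := algebraMap A B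
  have hι : Function.Injective ι :=
    IsLocalization.injective B 𝔪.primeCompl_le_nonZeroDivisors
  have hunit : ∀ y : 𝔪.primeCompl, IsUnit (φ y) := fun y => isUnit_iff_ne_zero.2 y.2
  let ψ : B →+* κ := IsLocalization.lift hunit
  have hψι : ∀ a, ψ (ι a) = φ a := IsLocalization.lift_eq hunit
  have hψιc : ψ.comp ι = φ := RingHom.ext hψι
  have hψ : Function.Surjective ψ := by
    intro z
    obtain ⟨a, b, hb, hz⟩ := hκ z
    let b' : 𝔪.primeCompl := ⟨b, fun h => hb ((RingHom.mem_ker).1 h)⟩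
    exact ⟨IsLocalization.mk' B a b', (IsLocalization.lift_mk'_spec hunit _ _ _).2
      (by rw [mul_comm]; exact hz.symm)⟩
  let _ := MvPolynomial.algebraMvPolynomial (σ := σ) (R := A) (S := B)
  have halg : algebraMap (MvPolynomial σ A) (MvPolynomial σ B) = MvPolynomial.map ι := rfl
  have hdisj : Disjoint ((𝔪.primeCompl.map (C (σ := σ)) : Submonoid _) : Set (MvPolynomial σ A))
      (𝔭 : Set (MvPolynomial σ A)) := by
    rw [Set.disjoint_left]
    rintro _ ⟨a, ha, rfl⟩ ha'
    exact ha (by rw [h𝔭 a ha']; exact zero_mem _)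
  let Q := 𝔭.map (MvPolynomial.map (σ := σ) ι)
  have hQ : Q.IsPrime := IsLocalization.isPrime_of_isPrime_disjoint
    (𝔪.primeCompl.map (C (σ := σ))) (MvPolynomial σ B) 𝔭 ‹_› hdisj
  have hgQ : MvPolynomial.map ι g ∉ Q := by
    intro hgQ
    have hmem : g ∈ (𝔭.map (algebraMap _ (MvPolynomial σ B))).under (MvPolynomial σ A) := hgQ
    rw [IsLocalization.under_map_of_isPrime_disjoint (𝔪.primeCompl.map (C (σ := σ)))
      (MvPolynomial σ B) ‹𝔭.IsPrime› hdisj] at hmem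
    exact hg hmem
  have hQJ : Q ⊔ Ideal.span {MvPolynomial.map ι g} =
      (𝔭 ⊔ Ideal.span {g}).map (MvPolynomial.map ι) := by
    rw [Ideal.map_sup, Ideal.map_span, Set.image_singleton]
  have hQφ : Q.map (MvPolynomial.map ψ) = 𝔭.map (MvPolynomial.map φ) := by
    have hcomp : (MvPolynomial.map (σ := σ) ψ).comp (MvPolynomial.map ι) = MvPolynomial.map φ := by
      ext <;> simp [hψι]
    rw [Ideal.map_map, hcomp]
  rw [← hQφ] at hh ⊢
  have hcancel : ∀ f : MvPolynomial σ A, MvPolynomial.map ψ (MvPolynomial.map ι f) = MvPolynomial.map φ f :=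
    fun f => by rw [MvPolynomial.map_map, hψιc]
  refine mem_map_of_mul_mem_map mo ψ hψ Q hgQ (fun b : s => MvPolynomial.map ι b.1)
    ?_ ?_ ?_ (by rwa [hcancel])
  · intro b
    rw [MonomialOrder.leadingCoeff, degree_map_of_injective mo hι, MvPolynomial.coeff_map]
    refine (IsLocalization.AtPrime.isUnit_to_map_iff B 𝔪 _).2 fun hker => hφc ?_
    rw [map_prod]
    exact Finset.prod_eq_zero b.2 hker
  · intro b
    rw [hQJ]
    exact Ideal.mem_map_of_mem _ (hs b b.2).1
  · intro f hf hf0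
    rw [hQJ] at hf
    obtain ⟨⟨⟨x, hx⟩, ⟨_, y, hy, rfl⟩⟩, hxy⟩ := (IsLocalization.mem_map_algebraMap_iff
      (𝔪.primeCompl.map (C (σ := σ))) (MvPolynomial σ B)).1 hf
    have hy0 : ι y ≠ 0 := fun h0 =>
      hy ((hι (h0.trans (map_zero ι).symm)).symm ▸ zero_mem 𝔪)
    have hxy' : f * C (ι y) = MvPolynomial.map ι x := by
      simpa [halg] using hxy
    have hdom : IsDomain B := IsLocalization.isDomain_localization 𝔪.primeCompl_le_nonZeroDivisors
    have hx0 : x ≠ 0 := by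
      rintro rfl
      rw [map_zero] at hxy'
      exact mul_ne_zero hf0 (C_ne_zero.2 hy0) hxy'
    have hdeg : mo.degree f = mo.degree x := by
      rw [← degree_map_of_injective mo hι, ← hxy', mo.degree_mul hf0 (C_ne_zero.2 hy0),
        mo.degree_C, add_zero]
    obtain ⟨b, hb, hbx⟩ := hsJ x hx hx0
    exact ⟨⟨b, hb⟩, by rwa [degree_map_of_injective mo hι, hdeg]⟩

theorem AlmostAll.mono {m : ℕ} {Q Q' : (Fin m → K) → Prop} (h : AlmostAll K m Q)
    (hQ : ∀ α, Q α → Q' α) : AlmostAll K m Q' :=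
  let ⟨c, hc, hα⟩ := h
  ⟨c, hc, fun α h => hQ α (hα α h)⟩

theorem AlmostAll.and {m : ℕ} {Q Q' : (Fin m → K) → Prop} (h : AlmostAll K m Q)
    (h' : AlmostAll K m Q') : AlmostAll K m fun α => Q α ∧ Q' α := by
  obtain ⟨c, hc, hα⟩ := h
  obtain ⟨c', hc', hα'⟩ := h'
  refine ⟨c * c', mul_ne_zero hc hc', fun α h => ?_⟩
  rw [map_mul] at h
  exact ⟨hα α (left_ne_zero_of_mul h), hα' α (right_ne_zero_of_mul h)⟩

theorem AlmostAll.forall {m : ℕ} {ι : Type*} [Fintype ι] {Q : ι → (Fin m → K) → Prop}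
    (h : ∀ i, AlmostAll K m (Q i)) : AlmostAll K m fun α => ∀ i, Q i α := by
  choose c hc hα using h
  refine ⟨∏ i, c i, Finset.prod_ne_zero_iff.2 fun i _ => hc i, fun α h i => hα i α ?_⟩
  rw [map_prod] at h
  exact Finset.prod_ne_zero_iff.1 h i (Finset.mem_univ i)

theorem coe_evalα {m : ℕ} (α : Fin m → K) (p : MvPolynomial (Fin m) k) :
    (evalα k K α p : K) = aeval α p := by
  have : (kA k K α).val.comp (MvPolynomial.aeval fun i =>
      (⟨α i, IntermediateField.subset_adjoin k (Set.range α) ⟨i, rfl⟩⟩ : kA k K α)) =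
      aeval α := by
    ext i
    simp
  exact DFunLike.congr_fun this p

theorem AlmostAll.of_evalα {m : ℕ} {Q : (Fin m → K) → Prop} {c : MvPolynomial (Fin m) k}
    (hc : c ≠ 0) (h : ∀ α, evalα k K α c ≠ 0 → Q α) : AlmostAll K m Q := by
  refine ⟨MvPolynomial.map (algebraMap k K) c, ?_, fun α hα => h α fun h0 => hα ?_⟩
  · exact (map_ne_zero_iff _ (MvPolynomial.map_injective _ (algebraMap k K).injective)).2 hc
  · rw [eval_map, ← aeval_def, ← coe_evalα, h0]
    rfl

theorem exists_mul_evalα_eq {m : ℕ} (α : Fin m → K) (z : kA k K α) :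
    ∃ a b, evalα k K α b ≠ 0 ∧ z * evalα k K α b = evalα k K α a := by
  obtain ⟨a, b, hz⟩ := (IntermediateField.mem_adjoin_range_iff k α z.1).1 z.2
  rw [← coe_evalα, ← coe_evalα] at hz
  by_cases hb : evalα k K α b = 0
  · refine ⟨0, 1, by simp, ?_⟩
    have : z = 0 := Subtype.ext (by simp [hz, hb])
    simp [this]
  · refine ⟨a, b, hb, Subtype.ext ?_⟩
    have hb' : (evalα k K α b : K) ≠ 0 := fun h => hb (Subtype.ext h)
    push_cast
    rw [hz, div_mul_cancel₀ _ hb']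

section Specialization

variable {m n : ℕ} {α : Fin m → K}

theorem toR_injective : Function.Injective (toR k m n) :=
  MvPolynomial.map_injective _ (IsFractionRing.injective _ _)

theorem ElemSpec.add {f g : Rg k m n} {fα gα : Ra k K n α} (hf : ElemSpec k K n α f fα)
    (hg : ElemSpec k K n α g gα) : ElemSpec k K n α (f + g) (fα + gα) := by
  obtain ⟨p, q, hq, h, h'⟩ := hf
  obtain ⟨p₁, q₁, hq₁, h₁, h₁'⟩ := hg
  refine ⟨C q₁ * p + C q * p₁, q * q₁, by rw [map_mul]; exact mul_ne_zero hq hq₁, ?_, ?_⟩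
  · simp only [toR, map_add, map_mul, map_C] at h h₁ ⊢
    linear_combination C (algebraMap _ (kU k m) q₁) * h + C (algebraMap _ (kU k m) q) * h₁
  · simp only [toRa, map_add, map_mul, map_C] at h' h₁' ⊢
    linear_combination C (evalα k K α q₁) * h' + C (evalα k K α q) * h₁'

theorem ElemSpec.mul {f g : Rg k m n} {fα gα : Ra k K n α} (hf : ElemSpec k K n α f fα)
    (hg : ElemSpec k K n α g gα) : ElemSpec k K n α (f * g) (fα * gα) := by
  obtain ⟨p, q, hq, h, h'⟩ := hf
  obtain ⟨p₁, q₁, hq₁, h₁, h₁'⟩ := hg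
  refine ⟨p * p₁, q * q₁, by rw [map_mul]; exact mul_ne_zero hq hq₁, ?_, ?_⟩
  · rw [map_mul (toR k m n), ← h, ← h₁]
    simp only [map_mul]
    ring
  · rw [map_mul (toRa k K n α), ← h', ← h₁']
    simp only [map_mul]
    ring

theorem ElemSpec.neg {f : Rg k m n} {fα : Ra k K n α} (hf : ElemSpec k K n α f fα) :
    ElemSpec k K n α (-f) (-fα) := by
  obtain ⟨p, q, hq, h, h'⟩ := hf
  exact ⟨-p, q, hq, by rw [map_neg]; linear_combination -h,
    by rw [map_neg]; linear_combination -h'⟩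

theorem ElemSpec.zero : ElemSpec k K n α 0 0 := ⟨0, 1, by simp, by simp, by simp⟩

theorem ElemSpec.one : ElemSpec k K n α 1 1 := ⟨1, 1, by simp, by simp, by simp⟩

theorem ElemSpec.eq_zero {fα : Ra k K n α} (hf : ElemSpec k K n α 0 fα) : fα = 0 := by
  obtain ⟨p, q, hq, h, h'⟩ := hf
  rw [mul_zero] at h
  have hp : p = 0 := toR_injective (h.symm.trans (map_zero _).symm)
  rw [hp, map_zero] at h'
  exact (mul_eq_zero.1 h').resolve_left (C_ne_zero.2 hq)

/-- Clearing the denominators of the coefficients of `f ∈ k(u)[X]`. -/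
theorem exists_C_mul_eq_toR (f : Rg k m n) :
    ∃ (p : MvPolynomial (Fin n) (MvPolynomial (Fin m) k)) (q : MvPolynomial (Fin m) k), q ≠ 0 ∧
      C (algebraMap (MvPolynomial (Fin m) k) (kU k m) q) * f = toR k m n p := by
  let _ := MvPolynomial.algebraMvPolynomial (σ := Fin n) (R := MvPolynomial (Fin m) k)
    (S := kU k m)
  obtain ⟨⟨p, ⟨_, q, hq, rfl⟩⟩, h⟩ := IsLocalization.surj
    ((nonZeroDivisors (MvPolynomial (Fin m) k)).map (C (σ := Fin n))) f
  refine ⟨p, q, nonZeroDivisors.ne_zero hq, ?_⟩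
  rw [mul_comm, toR, ← map_C]
  exact h

variable (P : Ideal (Rg k m n)) [P.IsPrime] (℘ : Ideal (Ra k K n α)) [℘.IsPrime]
  (S : Type) [CommRing S] [Algebra (Rg k m n) S] [IsLocalization.AtPrime S P]
  (Sα : Type) [CommRing Sα] [Algebra (Ra k K n α) Sα] [IsLocalization.AtPrime Sα ℘]

/-- The graph of the specialization of elements of `S = R_P`. -/
def locSpecGraph : Subring (S × Sα) where
  carrier := {a | LocElemSpec P ℘ a.1 a.2}
  zero_mem' := ⟨0, 1, 0, 1, one_mem _, one_mem _, .zero, .one,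
    (IsLocalization.mk'_zero _).symm, (IsLocalization.mk'_zero _).symm⟩
  one_mem' := ⟨1, 1, 1, 1, one_mem _, one_mem _, .one, .one,
    (IsLocalization.mk'_self _ _).symm, (IsLocalization.mk'_self _ _).symm⟩
  add_mem' := by
    rintro ⟨_, _⟩ ⟨_, _⟩ ⟨f, g, fα, gα, hg, hgα, h1, h2, rfl, rfl⟩
      ⟨f', g', fα', gα', hg', hgα', h1', h2', rfl, rfl⟩
    exact ⟨f * g' + f' * g, g * g', fα * gα' + fα' * gα, gα * gα', mul_mem hg hg',
      mul_mem hgα hgα', (h1.mul h2').add (h1'.mul h2), h2.mul h2',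
      (IsLocalization.mk'_add _ _ _ _).symm, (IsLocalization.mk'_add _ _ _ _).symm⟩
  mul_mem' := by
    rintro ⟨_, _⟩ ⟨_, _⟩ ⟨f, g, fα, gα, hg, hgα, h1, h2, rfl, rfl⟩
      ⟨f', g', fα', gα', hg', hgα', h1', h2', rfl, rfl⟩
    exact ⟨f * f', g * g', fα * fα', gα * gα', mul_mem hg hg', mul_mem hgα hgα',
      h1.mul h1', h2.mul h2', (IsLocalization.mk'_mul _ _ _ _ _).symm,
      (IsLocalization.mk'_mul _ _ _ _ _).symm⟩
  neg_mem' := by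
    rintro ⟨_, _⟩ ⟨f, g, fα, gα, hg, hgα, h1, h2, rfl, rfl⟩
    exact ⟨-f, g, -fα, gα, hg, hgα, h1.neg, h2, (IsLocalization.mk'_neg _ _ _).symm,
      (IsLocalization.mk'_neg _ _ _).symm⟩

variable {P ℘ S Sα}

theorem mem_locSpecGraph {a : S} {aα : Sα} :
    (a, aα) ∈ locSpecGraph P ℘ S Sα ↔ LocElemSpec P ℘ a aα := Iff.rfl

theorem LocElemSpec.eq_zero {aα : Sα} (h : LocElemSpec P ℘ (0 : S) aα) : aα = 0 := by
  obtain ⟨f, g, fα, gα, hg, hgα, h1, h2, h3, rfl⟩ := h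
  obtain ⟨⟨s, hs⟩, hsf⟩ := (IsLocalization.mk'_eq_zero_iff f _).1 h3.symm
  have hs0 : s ≠ 0 := fun h0 => hs (h0 ▸ P.zero_mem)
  obtain rfl : f = 0 := (mul_eq_zero.1 hsf).resolve_left hs0
  rw [h1.eq_zero, IsLocalization.mk'_zero]

/-- The specialization of an element of `S`, when it exists, is unique. -/
theorem LocElemSpec.unique {a : S} {b c : Sα} (hb : LocElemSpec P ℘ a b)
    (hc : LocElemSpec P ℘ a c) : b = c := by
  have h := (locSpecGraph P ℘ S Sα).sub_mem (mem_locSpecGraph.2 hb) (mem_locSpecGraph.2 hc)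
  rw [Prod.mk_sub_mk, sub_self] at h
  exact sub_eq_zero.1 (LocElemSpec.eq_zero (mem_locSpecGraph.1 h))

theorem LocElemSpec.add {a b : S} {aα bα : Sα} (ha : LocElemSpec P ℘ a aα)
    (hb : LocElemSpec P ℘ b bα) : LocElemSpec P ℘ (a + b) (aα + bα) :=
  (locSpecGraph P ℘ S Sα).add_mem (x := (a, aα)) (y := (b, bα)) ha hb

theorem LocElemSpec.mul {a b : S} {aα bα : Sα} (ha : LocElemSpec P ℘ a aα)
    (hb : LocElemSpec P ℘ b bα) : LocElemSpec P ℘ (a * b) (aα * bα) :=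
  (locSpecGraph P ℘ S Sα).mul_mem (x := (a, aα)) (y := (b, bα)) ha hb

theorem LocElemSpec.sum {ι : Type*} {s : Finset ι} {a : ι → S} {aα : ι → Sα}
    (h : ∀ i ∈ s, LocElemSpec P ℘ (a i) (aα i)) :
    LocElemSpec P ℘ (∑ i ∈ s, a i) (∑ i ∈ s, aα i) := by
  have := (locSpecGraph P ℘ S Sα).sum_mem (f := fun i => (a i, aα i)) h
  rwa [← prod_mk_sum] at this

end Specialization

theorem notMem_of_isAssociatedPrime_quotient {R : Type*} [CommRing R] {I ℘ : Ideal R}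
    (h℘ : IsAssociatedPrime ℘ (R ⧸ I)) {x : R} (hx : ∀ h, x * h ∈ I → h ∈ I) : x ∉ ℘ := by
  obtain ⟨y, hy⟩ := h℘.eq_radical_colon
  intro hmem
  rw [hy] at hmem
  obtain ⟨N, hN⟩ := hmem
  obtain ⟨h, rfl⟩ := Ideal.Quotient.mk_surjective y
  have hpow : ∀ N, x ^ N * h ∈ I → h ∈ I := by
    intro N
    induction N with
    | zero => simp
    | succ N ih => exact fun hN => ih (hx _ (by rwa [← mul_assoc, ← pow_succ']))
  have hh : h ∈ I := by
    refine hpow N ?_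
    rw [Submodule.mem_colon_singleton] at hN
    exact Ideal.Quotient.eq_zero_iff_mem.1 hN
  refine h℘.isPrime.ne_top ?_
  rw [hy, Ideal.Quotient.eq_zero_iff_mem.2 hh]
  refine (Ideal.eq_top_iff_one _).2 ⟨1, ?_⟩
  rw [Submodule.mem_colon_singleton]
  simp

theorem almostAll_specialization_notMem {m n : ℕ} (P : Ideal (Rg k m n)) [P.IsPrime]
    {g : Rg k m n} (hg : g ∉ P) :
    AlmostAll K m fun α => ∃ gα : Ra k K n α, ElemSpec k K n α g gα ∧
      ∀ ℘ : Ideal (Ra k K n α), IsAssociatedPrime ℘ (Ra k K n α ⧸ idealSpec k K n α P) →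
        gα ∉ ℘ := by
  obtain ⟨p, q, hq, hp⟩ := exists_C_mul_eq_toR g
  have hunit : ∀ q : MvPolynomial (Fin m) k, q ≠ 0 →
      IsUnit (C (algebraMap (MvPolynomial (Fin m) k) (kU k m) q) : Rg k m n) := fun q hq =>
    (isUnit_iff_ne_zero.2 ((map_ne_zero_iff _ (IsFractionRing.injective _ _)).2 hq)).map C
  obtain ⟨c, hc, H⟩ := exists_forall_mem_map_of_mul_mem_map (P.comap (toR k m n))
    (fun a ha => by
      by_contra h0
      rw [Ideal.mem_comap, toR, map_C] at ha
      exact ‹P.IsPrime›.ne_top (Ideal.eq_top_of_isUnit_mem _ ha (hunit a h0)))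
    (g := p) (by
      rw [Ideal.mem_comap, ← hp]
      intro h
      rcases ‹P.IsPrime›.mem_or_mem h with h | h
      · exact ‹P.IsPrime›.ne_top (Ideal.eq_top_of_isUnit_mem _ h (hunit q hq))
      · exact hg h)
  refine AlmostAll.of_evalα (mul_ne_zero hq hc) fun α hα => ?_
  rw [map_mul] at hα
  have hqα := left_ne_zero_of_mul hα
  have hC : C (evalα k K α q) * (C (evalα k K α q)⁻¹ * toRa k K n α p) = toRa k K n α p := by
    rw [← mul_assoc, ← C_mul, mul_inv_cancel₀ hqα, C_1, one_mul]
  refine ⟨C (evalα k K α q)⁻¹ * toRa k K n α p, ⟨p, q, hqα, hp, hC⟩, fun ℘ h℘ hmem => ?_⟩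
  refine notMem_of_isAssociatedPrime_quotient h℘ (x := toRa k K n α p) (fun h hh => ?_) ?_
  · exact H (evalα k K α) (right_ne_zero_of_mul hα) (exists_mul_evalα_eq α) h hh
  · rw [← hC]
    exact Ideal.mul_mem_left _ _ hmem

section Localization

variable {m n : ℕ} {S : Type} [CommRing S] [Algebra (Rg k m n) S]

/-- For almost all `α`, a given element of `S = R_P` has a specialization. -/
theorem almostAll_exists_locElemSpec (P : Ideal (Rg k m n)) [P.IsPrime]
    [IsLocalization.AtPrime S P] (a : S) :
    AlmostAll K m fun α => ∀ (℘ : Ideal (Ra k K n α))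
      (h℘ : IsAssociatedPrime ℘ ((Ra k K n α) ⧸ idealSpec k K n α P)),
      haveI := h℘.isPrime
      ∀ (Sα : Type) [CommRing Sα] [Algebra (Ra k K n α) Sα] [IsLocalization.AtPrime Sα ℘],
        ∃ aα : Sα, LocElemSpec P ℘ a aα := by
  obtain ⟨f, ⟨g, hg⟩, rfl⟩ := IsLocalization.exists_mk'_eq P.primeCompl a
  obtain ⟨p, q, hq, hp⟩ := exists_C_mul_eq_toR f
  refine ((almostAll_specialization_notMem P hg).and (AlmostAll.of_evalα
    (Q := fun α => evalα k K α q ≠ 0) hq fun α h => h)).mono ?_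
  rintro α ⟨⟨gα, hgα, hmem⟩, hqα⟩ ℘ h℘ Sα _ _ _
  have hC : C (evalα k K α q) * (C (evalα k K α q)⁻¹ * toRa k K n α p) = toRa k K n α p := by
    rw [← mul_assoc, ← C_mul, mul_inv_cancel₀ hqα, C_1, one_mul]
  have := h℘.isPrime
  exact ⟨_, f, g, _, gα, hg, hmem ℘ h℘, ⟨p, q, hqα, hp, hC⟩, hgα, rfl, rfl⟩

/-- A linear relation `π v ∈ ∑ S π(x_j)` in the module presented by `p` specializes. -/
theorem almostAll_mk_mem_span (P : Ideal (Rg k m n)) [P.IsPrime]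
    [IsLocalization.AtPrime S P] {L : Type} [AddCommGroup L] [Module S L] {r s : ℕ}
    (p : Present S r s L) {t : ℕ} (x : Fin t → Fin r → S) (v : Fin r → S)
    (hv : p.π v ∈ Submodule.span S (Set.range fun j => p.π (x j))) :
    AlmostAll K m fun α => ∀ (℘ : Ideal (Ra k K n α))
      (h℘ : IsAssociatedPrime ℘ ((Ra k K n α) ⧸ idealSpec k K n α P)),
      haveI := h℘.isPrime
      ∀ (Sα : Type) [CommRing Sα] [Algebra (Ra k K n α) Sα] [IsLocalization.AtPrime Sα ℘]
        (B : Matrix (Fin r) (Fin s) Sα) (y : Fin t → Fin r → Sα) (v' : Fin r → Sα),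
        MatSpec (LocElemSpec P ℘) p.A B → (∀ j i, LocElemSpec P ℘ (x j i) (y j i)) →
        (∀ i, LocElemSpec P ℘ (v i) (v' i)) →
        (Submodule.Quotient.mk v' : MatCoker B) ∈
          Submodule.span Sα (Set.range fun j => (Submodule.Quotient.mk (y j) : MatCoker B)) := by
  obtain ⟨c, hc⟩ := (Submodule.mem_span_range_iff_exists_fun S).1 hv
  have hker : v - ∑ j, c j • x j ∈ LinearMap.ker p.π := by
    rw [LinearMap.mem_ker, map_sub, map_sum, ← hc]
    simp
  rw [p.ker_eq] at hker
  obtain ⟨d, hd⟩ := hker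
  have hvcd : ∀ i, v i = ∑ j, c j * x j i + ∑ l, p.A i l * d l := by
    intro i
    have := congr_fun hd i
    simp only [Matrix.mulVecLin_apply, Matrix.mulVec, dotProduct, Pi.sub_apply,
      Finset.sum_apply, Pi.smul_apply, smul_eq_mul] at this
    rw [this]
    ring
  refine ((AlmostAll.forall fun j => almostAll_exists_locElemSpec P (c j)).and
    (AlmostAll.forall fun l => almostAll_exists_locElemSpec P (d l))).mono ?_
  rintro α ⟨hcα, hdα⟩ ℘ h℘ Sα _ _ _ B y v' hB hy hv'
  have := h℘.isPrime
  choose c' hc' using fun j => hcα j ℘ h℘ Sα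
  choose d' hd' using fun l => hdα l ℘ h℘ Sα
  have hv'cd : v' = ∑ j, c' j • y j + B.mulVecLin d' := by
    ext i
    simp only [Matrix.mulVecLin_apply, Matrix.mulVec, dotProduct, Pi.add_apply,
      Finset.sum_apply, Pi.smul_apply, smul_eq_mul]
    refine (hv' i).unique ?_
    rw [hvcd i]
    exact (LocElemSpec.sum fun j _ => (hc' j).mul (hy j i)).add
      (LocElemSpec.sum fun l _ => (hB i l).mul (hd' l))
  have hmk : (Submodule.Quotient.mk v' : MatCoker B) =
      ∑ j, c' j • (Submodule.Quotient.mk (y j) : MatCoker B) := by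
    rw [hv'cd, Submodule.Quotient.mk_add,
      (Submodule.Quotient.mk_eq_zero _).2 (LinearMap.mem_range_self _ d'), add_zero]
    exact map_sum (Submodule.mkQ _) _ _
  rw [hmk]
  exact Submodule.sum_mem _ fun j _ =>
    Submodule.smul_mem _ _ (Submodule.subset_span ⟨j, rfl⟩)

theorem range_cokerMap {S : Type} [CommRing S] {r s r' s' : ℕ} {B : Matrix (Fin r) (Fin s) S}
    {C : Matrix (Fin r') (Fin s') S} (W : Matrix (Fin r') (Fin r) S)
    (h : LinearMap.range B.mulVecLin ≤ (LinearMap.range C.mulVecLin).comap W.mulVecLin) :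
    LinearMap.range (cokerMap W h) =
      Submodule.span S (Set.range fun i => (Submodule.Quotient.mk (W.col i) : MatCoker C)) := by
  have := congr_arg (Submodule.map (LinearMap.range C.mulVecLin).mkQ) (Matrix.range_mulVecLin W)
  rw [Submodule.map_span, ← Set.range_comp] at this
  rw [cokerMap, Submodule.range_mapQ]
  exact this

/-- Generators of a submodule `N` of a presented module specialize to generators of the
specialization of `N`. -/
theorem almostAll_range_cokerMap (P : Ideal (Rg k m n)) [P.IsPrime]
    [IsLocalization.AtPrime S P] {L : Type} [AddCommGroup L] [Module S L] {r s r' s' : ℕ}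
    (p : Present S r s L) (N : Submodule S L) (pN : Present S r' s' N)
    (l : MapLift pN p N.subtype) {t : ℕ} (x : Fin t → Fin r → S)
    (hx : Submodule.span S (Set.range fun j => p.π (x j)) = N) :
    AlmostAll K m fun α => ∀ (℘ : Ideal (Ra k K n α))
      (h℘ : IsAssociatedPrime ℘ ((Ra k K n α) ⧸ idealSpec k K n α P)),
      haveI := h℘.isPrime
      ∀ (Sα : Type) [CommRing Sα] [Algebra (Ra k K n α) Sα] [IsLocalization.AtPrime Sα ℘]
        (B : Matrix (Fin r) (Fin s) Sα) (BN : Matrix (Fin r') (Fin s') Sα)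
        (W : Matrix (Fin r) (Fin r') Sα) (y : Fin t → Fin r → Sα),
        MatSpec (LocElemSpec P ℘) p.A B → MatSpec (LocElemSpec P ℘) l.V0 W →
        (∀ j i, LocElemSpec P ℘ (x j i) (y j i)) →
        ∀ h : LinearMap.range BN.mulVecLin ≤ (LinearMap.range B.mulVecLin).comap W.mulVecLin,
          LinearMap.range (cokerMap W h) =
            Submodule.span Sα (Set.range fun j => (Submodule.Quotient.mk (y j) : MatCoker B)) := by
  have hcomm : ∀ c, p.π (l.V0.mulVec c) = (pN.π c : L) := fun c =>
    LinearMap.congr_fun l.comm0 c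
  have hcol : ∀ i, p.π (l.V0.col i) = (pN.π (Pi.single i 1) : L) := fun i => by
    rw [← hcomm, Matrix.mulVec_single_one]
  have h1 : ∀ i, p.π (l.V0.col i) ∈ Submodule.span S (Set.range fun j => p.π (x j)) := by
    intro i
    rw [hx, hcol]
    exact Subtype.coe_prop _
  have h2 : ∀ j, p.π (x j) ∈ Submodule.span S (Set.range fun i => p.π (l.V0.col i)) := by
    intro j
    have hj : p.π (x j) ∈ N := hx ▸ Submodule.subset_span ⟨j, rfl⟩
    obtain ⟨c, hc⟩ := pN.surj ⟨p.π (x j), hj⟩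
    have hc' : p.π (x j) = p.π (l.V0.mulVec c) := by rw [hcomm, hc]
    rw [hc', Matrix.mulVec_eq_sum, map_sum]
    refine Submodule.sum_mem _ fun i _ => ?_
    rw [op_smul_eq_smul, map_smul]
    exact Submodule.smul_mem _ _ (Submodule.subset_span ⟨i, rfl⟩)
  refine ((AlmostAll.forall fun i => almostAll_mk_mem_span P p x _ (h1 i)).and
    (AlmostAll.forall fun j => almostAll_mk_mem_span P p _ _ (h2 j))).mono ?_
  rintro α ⟨H1, H2⟩ ℘ h℘ Sα _ _ _ B BN W y hB hW hy h
  rw [range_cokerMap]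
  refine le_antisymm (Submodule.span_le.2 ?_) (Submodule.span_le.2 ?_)
  · rintro _ ⟨i, rfl⟩
    exact H1 i ℘ h℘ Sα B y _ hB hy fun a => hW a i
  · rintro _ ⟨j, rfl⟩
    exact H2 j ℘ h℘ Sα B (fun i => W.col i) _ hB (fun i a => hW a i) (hy j)

end Localization

/-- if `L = Se_1 + ⋯ + Se_t`, then for almost all `α` there are
elements `(e_j)_α ∈ L_α` (the images of the specialized coordinate vectors of the
`e_j`) with `(Se_j)_α = S_α (e_j)_α` and `L_α = S_α(e_1)_α + ⋯ + S_α(e_t)_α`.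
In particular, for an ideal `𝔞 = (a_1, …, a_t')` of `S`, its specialization
(the specialized submodule of `S_α`) is the ideal generated by `(a_1)_α, …, (a_t')_α`. -/
theorem specialization_of_generators
    (k K : Type) [Field k] [Field K] [Algebra k K] [Infinite K] {m n : ℕ}
    (P : Ideal (Rg k m n)) [P.IsPrime]
    (S : Type) [CommRing S] [Algebra (Rg k m n) S] [IsLocalization.AtPrime S P]
    (L : Type) [AddCommGroup L] [Module S L] [Module.Finite S L]
    {rL sL : ℕ} (pL : Present S rL sL L)
    {t : ℕ} (e : Fin t → L) (he : Submodule.span S (Set.range e) = ⊤)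
    (x : Fin t → (Fin rL → S)) (hx : ∀ j, pL.π (x j) = e j)
    (rE sE : Fin t → ℕ)
    (pE : ∀ j, Present S (rE j) (sE j) (Submodule.span S {e j}))
    (lE : ∀ j, MapLift (pE j) pL (Submodule.span S {e j}).subtype)
    -- data for the ideal case: 𝔞 = (a_1, …, a_t') ⊆ S, S presented by pS
    (𝔞 : Ideal S) {t' : ℕ} (a : Fin t' → S) (ha : Ideal.span (Set.range a) = 𝔞)
    {rS sS r𝔞 s𝔞 : ℕ} (pS : Present S rS sS S) (p𝔞 : Present S r𝔞 s𝔞 𝔞)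
    (l𝔞 : MapLift p𝔞 pS 𝔞.subtype)
    (w : Fin t' → (Fin rS → S)) (hw : ∀ j, pS.π (w j) = a j) :
    AlmostAll K m fun α =>
      ∀ (℘ : Ideal (Ra k K n α))
        (h℘ : IsAssociatedPrime ℘ ((Ra k K n α) ⧸ idealSpec k K n α P)),
        haveI := h℘.isPrime
        ∀ (Sα : Type) [CommRing Sα] [Algebra (Ra k K n α) Sα]
          [IsLocalization.AtPrime Sα ℘]
          (BL : Matrix (Fin rL) (Fin sL) Sα)
          (y : Fin t → (Fin rL → Sα))
          (BE : ∀ j, Matrix (Fin (rE j)) (Fin (sE j)) Sα)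
          (u0 : ∀ j, Matrix (Fin rL) (Fin (rE j)) Sα)
          (BS : Matrix (Fin rS) (Fin sS) Sα) (B𝔞 : Matrix (Fin r𝔞) (Fin s𝔞) Sα)
          (v0 : Matrix (Fin rS) (Fin r𝔞) Sα)
          (z : Fin t' → (Fin rS → Sα)),
          MatSpec (LocElemSpec P ℘) pL.A BL →
          (∀ j i, LocElemSpec P ℘ (x j i) (y j i)) →
          (∀ j, MatSpec (LocElemSpec P ℘) (pE j).A (BE j)) →
          (∀ j, MatSpec (LocElemSpec P ℘) (lE j).V0 (u0 j)) →
          MatSpec (LocElemSpec P ℘) pS.A BS →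
          MatSpec (LocElemSpec P ℘) p𝔞.A B𝔞 →
          MatSpec (LocElemSpec P ℘) l𝔞.V0 v0 →
          (∀ j i, LocElemSpec P ℘ (w j i) (z j i)) →
          -- `L_α = S_α (e_1)_α + ⋯ + S_α (e_t)_α`
          (Submodule.span Sα
            (Set.range fun j => (Submodule.Quotient.mk (y j) : MatCoker BL)) = ⊤) ∧
          -- `(Se_j)_α = S_α (e_j)_α` inside `L_α`
          (∀ j, ∀ h : LinearMap.range (BE j).mulVecLin ≤
              (LinearMap.range BL.mulVecLin).comap (u0 j).mulVecLin,
            LinearMap.range (cokerMap (u0 j) h) =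
              Submodule.span Sα {(Submodule.Quotient.mk (y j) : MatCoker BL)}) ∧
          -- `𝔞_α = ((a_1)_α, …, (a_t')_α)` inside `S_α ≅ coker BS`
          (∀ h : LinearMap.range B𝔞.mulVecLin ≤
              (LinearMap.range BS.mulVecLin).comap v0.mulVecLin,
            LinearMap.range (cokerMap v0 h) =
              Submodule.span Sα
                (Set.range fun j => (Submodule.Quotient.mk (z j) : MatCoker BS))) := by
  have hx' : (fun j => pL.π (x j)) = e := funext hx
  have hw' : (fun j => pS.π (w j)) = a := funext hw
  have h1 := AlmostAll.forall (K := K) fun i => almostAll_mk_mem_span P pL x (Pi.single i (1 : S))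
    (by rw [hx', he]; exact Submodule.mem_top)
  have h2 := AlmostAll.forall (K := K) fun j => almostAll_range_cokerMap P pL _ (pE j) (lE j)
    (fun _ : Fin 1 => x j) (by rw [Set.range_const, hx])
  have h3 := almostAll_range_cokerMap (K := K) P pS 𝔞 p𝔞 l𝔞 w (by rw [hw']; exact ha)
  refine ((h1.and h2).and h3).mono ?_
  rintro α ⟨⟨h1, h2⟩, h3⟩ ℘ h℘ Sα _ _ _ BL y BE u0 BS B𝔞 v0 z hBL hy hBE hu0 hBS hB𝔞 hv0 hz
  have := h℘.isPrime
  refine ⟨?_, fun j h => ?_, fun h => h3 ℘ h℘ Sα BS B𝔞 v0 z hBS hv0 hz h⟩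
  · rw [eq_top_iff]
    rintro q -
    obtain ⟨v, rfl⟩ := Submodule.Quotient.mk_surjective _ q
    have hsum : (Submodule.Quotient.mk (∑ i, v i • Pi.single i (1 : Sα)) : MatCoker BL) =
        ∑ i, v i • (Submodule.Quotient.mk (Pi.single i (1 : Sα)) : MatCoker BL) :=
      map_sum (Submodule.mkQ _) _ _
    have hv : v = ∑ i, v i • Pi.single i (1 : Sα) := pi_eq_sum_univ' v
    rw [hv, hsum]
    refine Submodule.sum_mem _ fun i _ => Submodule.smul_mem _ _ ?_
    refine h1 i ℘ h℘ Sα BL y _ hBL hy fun l => ?_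
    rcases eq_or_ne l i with rfl | hl
    · rw [Pi.single_eq_same, Pi.single_eq_same]
      exact mem_locSpecGraph.1 (one_mem _)
    · rw [Pi.single_eq_of_ne hl, Pi.single_eq_of_ne hl]
      exact mem_locSpecGraph.1 (zero_mem _)
  · have := h2 j ℘ h℘ Sα BL (BE j) (u0 j) (fun _ => y j) hBL (hu0 j) (fun _ => hy j) h
    rwa [Set.range_const] at this

end Spl
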